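/- arXiv:1602.05394 — 4 statements merged into one kernel-verified Lean document; each statement's English description precedes it below -/
import Mathlib

section
/- Online projected subgradient method, strongly convex case (Lemma 1, second part): Let Λ be a nonempty closed convex subset of ℝ^m. Let T ≥ 1, κ > 0, G > 0, and let g_1,…,g_T : ℝ^m → ℝ. Suppose a sequence λ_1,…,λ_T is generated as follows: λ_1 ∈ Λ, and for each t, h_t ∈ ℝ^m satisfies ‖h_t‖₂ ≤ G and the strong-subgradient inequality g_t(μ) ≥ g_t(λ_t) + ⟨h_t, μ − λ_t⟩ + (κ/2)‖μ − λ_t‖₂² for all μ ∈ Λ, and λ_{t+1} = Π_Λ(λ_t − η_t h_t) with step size η_t = 1/(κ t). Then for every λ ∈ Λ, (1/T) Σ_{t=1}^T ( g_t(λ_t) − g_t(λ) ) ≤ (G²/(2κT)) log(eT). -/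
local notation "⟪" x ", " y "⟫" => @inner ℝ _ _ x y

section Projection

variable {E : Type*} [NormedAddCommGroup E] [InnerProductSpace ℝ E]

/-- Replacing a point by a nearest point of a convex set does not increase its distance to the
points of that set. -/
theorem norm_sub_le_of_isNearest {C : Set E} (hC : Convex ℝ C) {y p z : E} (hp : p ∈ C)
    (hmin : ∀ w ∈ C, ‖y - p‖ ≤ ‖y - w‖) (hz : z ∈ C) : ‖p - z‖ ≤ ‖y - z‖ := by
  have : Nonempty C := ⟨⟨p, hp⟩⟩
  have hinf : ‖y - p‖ = ⨅ w : C, ‖y - w‖ :=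
    le_antisymm (le_ciInf fun w => hmin w w.2)
      (ciInf_le (f := fun w : C => ‖y - w‖)
        ⟨0, by rintro _ ⟨w, rfl⟩; exact norm_nonneg _⟩ ⟨p, hp⟩)
  have hinner := (norm_eq_iInf_iff_real_inner_le_zero hC hp).1 hinf z hz
  have hexpand := norm_sub_sq_real (y - p) (z - p)
  rw [sub_sub_sub_cancel_right] at hexpand
  rw [norm_sub_rev p z]
  refine le_of_sq_le_sq ?_ (norm_nonneg _)
  nlinarith [sq_nonneg ‖y - p‖]

/-- The one-step inequality of the projected subgradient method with step size `η`. -/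
theorem two_mul_inner_le_of_isNearest {C : Set E} (hC : Convex ℝ C) {x v p z : E} {η G : ℝ}
    (hv : ‖v‖ ≤ G) (hp : p ∈ C) (hmin : ∀ w ∈ C, ‖x - η • v - p‖ ≤ ‖x - η • v - w‖)
    (hz : z ∈ C) :
    2 * η * inner ℝ v (x - z) ≤ ‖x - z‖ ^ 2 - ‖p - z‖ ^ 2 + η ^ 2 * G ^ 2 := by
  have hle := pow_le_pow_left₀ (norm_nonneg _) (norm_sub_le_of_isNearest hC hp hmin hz) 2
  have hexpand := norm_sub_sq_real (x - z) (η • v)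
  rw [inner_smul_right, real_inner_comm, norm_smul, mul_pow, Real.norm_eq_abs, sq_abs,
    sub_right_comm] at hexpand
  have hv2 := mul_le_mul_of_nonneg_left (pow_le_pow_left₀ (norm_nonneg v) hv 2) (sq_nonneg η)
  linarith

end Projection

/-- Online projected subgradient method, strongly convex case (Lemma 1, second part).
Rounds are indexed by `t ∈ {0, …, T-1}` (round `t+1` in the paper), so the step size
`η_t = 1/(κ t)` of the paper becomes `1/(κ (t+1))` here. `log (e T)` is written as
`Real.log (Real.exp 1 * T)`. -/
theorem stmt_1 {m : ℕ} (Λ : Set (EuclideanSpace ℝ (Fin m)))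
    (hΛne : Λ.Nonempty) (hΛclosed : IsClosed Λ) (hΛconvex : Convex ℝ Λ)
    (T : ℕ) (hT : 1 ≤ T)
    (κ : ℝ) (hκ : 0 < κ) (G : ℝ) (hG : 0 < G)
    (g : ℕ → EuclideanSpace ℝ (Fin m) → ℝ)
    (lam h : ℕ → EuclideanSpace ℝ (Fin m))
    (hlam0 : lam 0 ∈ Λ)
    (hhG : ∀ t ∈ Finset.range T, ‖h t‖ ≤ G)
    (hsubgrad : ∀ t ∈ Finset.range T, ∀ μ ∈ Λ,
      g t μ ≥ g t (lam t) + ⟪h t, μ - lam t⟫ + (κ / 2) * ‖μ - lam t‖ ^ 2)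
    (hproj : ∀ t ∈ Finset.range T, lam (t + 1) ∈ Λ ∧
      ∀ z ∈ Λ, ‖lam t - (1 / (κ * (t + 1))) • h t - lam (t + 1)‖ ≤
        ‖lam t - (1 / (κ * (t + 1))) • h t - z‖) :
    ∀ lam' ∈ Λ,
      (1 / T : ℝ) * ∑ t ∈ Finset.range T, (g t (lam t) - g t lam') ≤
        (G ^ 2 / (2 * κ * T)) * Real.log (Real.exp 1 * T) := by
  intro z hz
  have hstep : ∀ t ∈ Finset.range T, g t (lam t) - g t z ≤
      κ / 2 * (t * ‖lam t - z‖ ^ 2 - (t + 1) * ‖lam (t + 1) - z‖ ^ 2) +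
        G ^ 2 / (2 * κ) * ((t : ℝ) + 1)⁻¹ := by
    intro t ht
    have hpos : (0 : ℝ) < t + 1 := by positivity
    have hinner := two_mul_inner_le_of_isNearest hΛconvex (hhG t ht) (hproj t ht).1
      (hproj t ht).2 hz
    have hsub := hsubgrad t ht z hz
    rw [← neg_sub (lam t) z, inner_neg_right, norm_neg] at hsub
    have hscaled := mul_le_mul_of_nonneg_left hinner
      (by positivity : 0 ≤ κ * ((t : ℝ) + 1) / 2)
    have hleft : κ * ((t : ℝ) + 1) / 2 * (2 * (1 / (κ * (t + 1))) * ⟪h t, lam t - z⟫) =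
        ⟪h t, lam t - z⟫ := by
      field_simp
    have hright : κ * ((t : ℝ) + 1) / 2 * ((1 / (κ * (t + 1))) ^ 2 * G ^ 2) =
        G ^ 2 / (2 * κ) * ((t : ℝ) + 1)⁻¹ := by
      field_simp
    rw [hleft, mul_add, hright] at hscaled
    linarith
  have htele : ∑ t ∈ Finset.range T,
      ((t : ℝ) * ‖lam t - z‖ ^ 2 - (t + 1) * ‖lam (t + 1) - z‖ ^ 2) =
        -(T * ‖lam T - z‖ ^ 2) := by
    have hsub := Finset.sum_range_sub' (fun t : ℕ => (t : ℝ) * ‖lam t - z‖ ^ 2) T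
    push_cast at hsub
    rw [hsub, zero_mul, zero_sub]
  have hharm : ∑ t ∈ Finset.range T, ((t : ℝ) + 1)⁻¹ ≤ Real.log (Real.exp 1 * T) := by
    have hT0 : (T : ℝ) ≠ 0 := by positivity
    rw [Real.log_mul (Real.exp_ne_zero 1) hT0, Real.log_exp]
    simpa [harmonic] using harmonic_le_one_add_log T
  have hsum : ∑ t ∈ Finset.range T, (g t (lam t) - g t z) ≤
      G ^ 2 / (2 * κ) * Real.log (Real.exp 1 * T) := by
    have hle := Finset.sum_le_sum hstep
    rw [Finset.sum_add_distrib, ← Finset.mul_sum, ← Finset.mul_sum, htele] at hle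
    have hdist : 0 ≤ κ / 2 * (T * ‖lam T - z‖ ^ 2) := by positivity
    have hG2 := mul_le_mul_of_nonneg_left hharm (by positivity : 0 ≤ G ^ 2 / (2 * κ))
    linarith
  calc (1 / T : ℝ) * ∑ t ∈ Finset.range T, (g t (lam t) - g t z)
      ≤ 1 / T * (G ^ 2 / (2 * κ) * Real.log (Real.exp 1 * T)) := by gcongr
    _ = G ^ 2 / (2 * κ * T) * Real.log (Real.exp 1 * T) := by field_simp
end

section
/- Lemma 2 (dual expression of the worst-case dual-sequence gap): Let ℰ : ℝ^m → ℝ be convex, let ℰ*(λ) = sup_{z ∈ ℝ^m} (⟨λ, z⟩ − ℰ(z)) be its Fenchel conjugate, and assume Λ := {λ ∈ ℝ^m : ℰ*(λ) < +∞} is nonempty and compact. Let T ≥ 2, let e₁*,…,e_T* ∈ ℝ^m, let ē = (1/T) Σ_{t=1}^T e_t*, let ε > 0, and define S_e as the supremum over all (λ_1,…,λ_T) ∈ Λ^T with Σ_{t=1}^{T−1} ‖λ_t − λ_{t+1}‖₂ ≤ ε of (1/T) Σ_{t=1}^T ( ⟨λ_t, e_t*⟩ − ℰ*(λ_t) ) −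 ℰ(ē). Then S_e equals the infimum over all α = (α_1,…,α_{T−1}) ∈ (ℝ^m)^{T−1} of (1/T) Σ_{t=1}^T ℰ( e_t* − (α_t − α_{t−1}) ) − ℰ(ē) + (ε/T) max_{1 ≤ t ≤ T−1} ‖α_t‖₂, where by convention α_0 = α_T = 0. -/
local notation "⟪" x ", " y "⟫" => @inner ℝ _ _ x y

/-- A finite convex function `f` on `C × Y` whose slice at `0` is bounded below by `v` has an
affine minorant in the second variable, uniformly in the first, taking the value `v` at `0`. -/
theorem exists_linearMap_add_le_of_convexOn {X Y : Type*} [AddCommGroup X] [Module ℝ X]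
    [AddCommGroup Y] [Module ℝ Y] {C : Set X} (hC : C.Nonempty) {f : X × Y → ℝ}
    (hf : ConvexOn ℝ (C ×ˢ Set.univ) f) {v : ℝ} (hv : ∀ a ∈ C, v ≤ f (a, 0)) :
    ∃ L : Y →ₗ[ℝ] ℝ, ∀ a ∈ C, ∀ y, v + L y ≤ f (a, y) := by
  obtain ⟨a₀, ha₀⟩ := hC
  have hcomb {a b : X} {y w z : Y} {p q : ℝ} (ha : a ∈ C) (hb : b ∈ C) (hp : 0 ≤ p) (hq : 0 ≤ q)
      (hpq : p + q = 1) (hz : p • y + q • w = z) :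
      p • a + q • b ∈ C ∧ f (p • a + q • b, z) ≤ p * f (a, y) + q * f (b, w) := by
    have hay : (a, y) ∈ C ×ˢ (Set.univ : Set Y) := ⟨ha, trivial⟩
    have hbw : (b, w) ∈ C ×ˢ (Set.univ : Set Y) := ⟨hb, trivial⟩
    subst hz
    exact ⟨(hf.1 hay hbw hp hq hpq).1, hf.2 hay hbw hp hq hpq⟩
  let q (y : Y) (i : Set.Ioi (0 : ℝ) × C) : ℝ := (f (i.2, i.1.1 • y) - v) / i.1
  have hbdd (y : Y) : BddBelow (Set.range (q y)) := by
    refine ⟨v - f (a₀, -y), ?_⟩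
    rintro _ ⟨⟨⟨s, hs⟩, ⟨a, ha⟩⟩, rfl⟩
    have hs : 0 < s := hs
    have h1 : (1 + s) ≠ 0 := by positivity
    obtain ⟨hm, h⟩ := hcomb (p := 1 / (1 + s)) (q := s / (1 + s)) (y := s • y) (w := -y) (z := 0)
      ha ha₀ (by positivity) (by positivity) (by field_simp) (by module)
    have h3 := (hv _ hm).trans h
    change v - f (a₀, -y) ≤ (f (a, s • y) - v) / s
    rw [le_div_iff₀ hs]
    field_simp at h3
    linarith
  have hne : Nonempty (Set.Ioi (0 : ℝ) × C) := ⟨⟨1, Set.mem_Ioi.2 one_pos⟩, ⟨a₀, ha₀⟩⟩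
  obtain ⟨L, -, hL⟩ := exists_extension_of_le_sublinear (⊥ : Y →ₗ.[ℝ] ℝ) (fun y => ⨅ i, q y i)
    (by
      have key (c : ℝ) (hc : 0 < c) (y : Y) : c * (⨅ i, q y i) ≤ ⨅ i, q (c • y) i := by
        refine le_ciInf fun i => ?_
        obtain ⟨⟨s, hs⟩, a⟩ := i
        have hs : 0 < s := hs
        have h := ciInf_le (hbdd y) (⟨s * c, mul_pos hs hc⟩, a)
        simp only [q, mul_smul] at h ⊢
        calc _ ≤ c * _ := mul_le_mul_of_nonneg_left h hc.le
          _ = _ := by field_simp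
      intro c hc y
      refine le_antisymm ?_ (key c hc y)
      have h := key c⁻¹ (inv_pos.2 hc) (c • y)
      rw [inv_smul_smul₀ hc.ne', inv_mul_le_iff₀ hc] at h
      exact h)
    (by
      intro x y
      refine le_ciInf_add_ciInf fun i j => ?_
      obtain ⟨⟨s, hs⟩, ⟨a, ha⟩⟩ := i
      obtain ⟨⟨r, hr⟩, ⟨b, hb⟩⟩ := j
      have hs : 0 < s := hs
      have hr : 0 < r := hr
      have hsr : s + r ≠ 0 := by positivity
      obtain ⟨hm, h⟩ := hcomb (p := r / (s + r)) (q := s / (s + r)) (y := s • x) (w := r • y)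
        (z := (r * s / (s + r)) • (x + y)) ha hb (by positivity) (by positivity)
        (by field_simp; ring) (by module)
      have hu : 0 < r * s / (s + r) := by positivity
      refine (ciInf_le (hbdd (x + y)) (⟨_, hu⟩, ⟨_, hm⟩)).trans ?_
      simp only [q]
      rw [div_le_iff₀ hu]
      refine (sub_le_sub_right h v).trans (le_of_eq ?_)
      field_simp
      ring)
    (by
      rintro ⟨x, hx⟩
      obtain rfl : x = 0 := (Submodule.mem_bot ℝ).1 hx
      have h0 : (⊥ : Y →ₗ.[ℝ] ℝ) ⟨0, hx⟩ = 0 := LinearPMap.map_zero _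
      rw [h0]
      refine le_ciInf fun i => div_nonneg ?_ (le_of_lt i.1.2)
      rw [smul_zero, sub_nonneg]
      exact hv _ i.2.2)
  refine ⟨L, fun a ha y => ?_⟩
  have h := (hL y).trans (ciInf_le (hbdd y) (⟨1, Set.mem_Ioi.2 one_pos⟩, ⟨a, ha⟩))
  simp only [q, one_smul, div_one] at h
  linarith

/-- If every selection from sets with least upper bounds `s i` has sum at most `K`, then so does
the sum of the `s i`. -/
theorem sum_le_of_forall_isLUB {ι Z : Type*} [Nonempty Z] {I : Finset ι} {g : ι → Z → ℝ} {s : ι → ℝ} {K : ℝ}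
    (hs : ∀ i ∈ I, IsLUB (Set.range (g i)) (s i))
    (hK : ∀ z : ι → Z, ∑ i ∈ I, g i (z i) ≤ K) : ∑ i ∈ I, s i ≤ K := by
  refine le_of_forall_pos_sub_le fun δ hδ => ?_
  have hc : (0 : ℝ) < I.card + 1 := by positivity
  have hex (i : ι) : ∃ z, i ∈ I → s i - δ / (I.card + 1) ≤ g i z := by
    by_cases hi : i ∈ I
    · obtain ⟨_, ⟨z, rfl⟩, hz⟩ :=
        (lt_isLUB_iff (hs i hi)).1 (sub_lt_self (s i) (div_pos hδ hc))
      exact ⟨z, fun _ => hz.le⟩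
    · exact ⟨Classical.arbitrary Z, fun h => absurd h hi⟩
  choose z hz using hex
  have h := (Finset.sum_le_sum hz).trans (hK z)
  rw [Finset.sum_sub_distrib, Finset.sum_const, nsmul_eq_mul] at h
  have : (I.card : ℝ) * (δ / (I.card + 1)) ≤ δ := by
    rw [mul_div_assoc', div_le_iff₀ hc]
    linarith
  linarith

/-- Summation by parts for inner products. -/
theorem sum_inner_sub_eq {V : Type*} [NormedAddCommGroup V] [InnerProductSpace ℝ V]
    (l α : ℕ → V) (n : ℕ) :
    ∑ t ∈ Finset.range (n + 1), ⟪l t, α (t + 1) - α t⟫ =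
      ⟪l n, α (n + 1)⟫ - ⟪l 0, α 0⟫ +
        ∑ t ∈ Finset.range n, ⟪l t - l (t + 1), α (t + 1)⟫ := by
  induction n with
  | zero => simp [inner_sub_right]
  | succ k ih =>
    rw [Finset.sum_range_succ, ih, Finset.sum_range_succ]
    simp only [inner_sub_left, inner_sub_right]
    ring

section Duality

variable {V : Type*} [NormedAddCommGroup V] [InnerProductSpace ℝ V]

/-- Weak duality between dual sequences of bounded path length and `α`-perturbations. -/
theorem sum_inner_sub_conjugate_le {E Estar : V → ℝ} {n : ℕ} (hn : (Finset.range n).Nonempty)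
    {e lam α : ℕ → V} {ε : ℝ}
    (hstar : ∀ t ∈ Finset.range (n + 1),
      IsLUB (Set.range fun z => ⟪lam t, z⟫ - E z) (Estar (lam t)))
    (hlam : ∑ t ∈ Finset.range n, ‖lam t - lam (t + 1)‖ ≤ ε)
    (h0 : α 0 = 0) (h1 : α (n + 1) = 0) :
    ∑ t ∈ Finset.range (n + 1), (⟪lam t, e t⟫ - Estar (lam t)) ≤
      ∑ t ∈ Finset.range (n + 1), E (e t - (α (t + 1) - α t)) +
        ε * (Finset.range n).sup' hn fun t => ‖α (t + 1)‖ := by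
  set M := (Finset.range n).sup' hn fun t => ‖α (t + 1)‖
  have hM : 0 ≤ M := by
    obtain ⟨t, ht⟩ := hn
    exact (norm_nonneg _).trans (Finset.le_sup' (fun t => ‖α (t + 1)‖) ht)
  have hab := sum_inner_sub_eq lam α n
  rw [h0, h1, inner_zero_right, inner_zero_right, sub_zero, zero_add] at hab
  have hpath : ∑ t ∈ Finset.range n, ⟪lam t - lam (t + 1), α (t + 1)⟫ ≤ ε * M := by
    refine le_trans ?_ (mul_le_mul_of_nonneg_right hlam hM)
    rw [Finset.sum_mul]
    refine Finset.sum_le_sum fun t ht => (real_inner_le_norm _ _).trans ?_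
    exact mul_le_mul_of_nonneg_left (Finset.le_sup' (fun t => ‖α (t + 1)‖) ht) (norm_nonneg _)
  have hE : ∑ t ∈ Finset.range (n + 1), (⟪lam t, e t⟫ - Estar (lam t)) ≤
      ∑ t ∈ Finset.range (n + 1),
        (E (e t - (α (t + 1) - α t)) + ⟪lam t, α (t + 1) - α t⟫) := by
    refine Finset.sum_le_sum fun t ht => ?_
    have h := (hstar t ht).1 ⟨e t - (α (t + 1) - α t), rfl⟩
    simp only [inner_sub_right] at h ⊢
    linarith
  rw [Finset.sum_add_distrib] at hE
  linarith

theorem convexOn_sum_add_sup' {E : V → ℝ} (hE : ConvexOn ℝ Set.univ E) {n : ℕ}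
    (hn : (Finset.range n).Nonempty) (e : ℕ → V) {ε : ℝ} (hε : 0 ≤ ε) :
    ConvexOn ℝ ({α : ℕ → V | α 0 = 0 ∧ α (n + 1) = 0} ×ˢ (Set.univ : Set (ℕ → V)))
      fun p => ∑ t ∈ Finset.range (n + 1), E (e t + p.2 t - (p.1 (t + 1) - p.1 t)) +
        ε * (Finset.range n).sup' hn fun t => ‖p.1 (t + 1)‖ := by
  constructor
  · rintro ⟨α, y⟩ ⟨⟨h0, h1⟩, -⟩ ⟨β, w⟩ ⟨⟨h2, h3⟩, -⟩ a b - - -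
    simp only at h0 h1 h2 h3
    refine ⟨⟨?_, ?_⟩, trivial⟩ <;> simp [h0, h1, h2, h3]
  · rintro ⟨α, y⟩ - ⟨β, w⟩ - a b ha hb hab
    simp only [Prod.smul_mk, Prod.mk_add_mk, Pi.add_apply, Pi.smul_apply, smul_eq_mul]
    have h1 : ∑ t ∈ Finset.range (n + 1), E (e t + (a • y t + b • w t) -
          (a • α (t + 1) + b • β (t + 1) - (a • α t + b • β t))) ≤
        ∑ t ∈ Finset.range (n + 1), (a * E (e t + y t - (α (t + 1) - α t)) +
          b * E (e t + w t - (β (t + 1) - β t))) := by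
      refine Finset.sum_le_sum fun t _ => ?_
      have h := hE.2 (Set.mem_univ (e t + y t - (α (t + 1) - α t)))
        (Set.mem_univ (e t + w t - (β (t + 1) - β t))) ha hb hab
      refine le_trans (le_of_eq (congrArg E ?_)) h
      obtain rfl : b = 1 - a := by linarith
      module
    have h2 : ((Finset.range n).sup' hn fun t => ‖a • α (t + 1) + b • β (t + 1)‖) ≤
        a * ((Finset.range n).sup' hn fun t => ‖α (t + 1)‖) +
          b * ((Finset.range n).sup' hn fun t => ‖β (t + 1)‖) := by
      refine Finset.sup'_le _ _ fun t ht => (norm_add_le _ _).trans ?_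
      rw [norm_smul, norm_smul, Real.norm_of_nonneg ha, Real.norm_of_nonneg hb]
      exact add_le_add
        (mul_le_mul_of_nonneg_left (Finset.le_sup' (fun t => ‖α (t + 1)‖) ht) ha)
        (mul_le_mul_of_nonneg_left (Finset.le_sup' (fun t => ‖β (t + 1)‖) ht) hb)
    rw [Finset.sum_add_distrib, ← Finset.mul_sum, ← Finset.mul_sum] at h1
    have h3 := mul_le_mul_of_nonneg_left h2 hε
    linarith

/-- Strong duality with dual attainment: any lower bound of the perturbed problem is attained by
a dual sequence of bounded path length. -/
theorem exists_le_sum_inner_sub_conjugate [FiniteDimensional ℝ V] {E Estar : V → ℝ}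
    (hE : ConvexOn ℝ Set.univ E) {Λ : Set V}
    (hdom : ∀ lam, lam ∈ Λ ↔ BddAbove (Set.range fun z => ⟪lam, z⟫ - E z))
    (hstar : ∀ lam ∈ Λ, IsLUB (Set.range fun z => ⟪lam, z⟫ - E z) (Estar lam))
    {n : ℕ} (hn : (Finset.range n).Nonempty) (e : ℕ → V) {ε : ℝ} (hε : 0 ≤ ε) {v : ℝ}
    (hv : ∀ α : ℕ → V, α 0 = 0 → α (n + 1) = 0 →
      v ≤ ∑ t ∈ Finset.range (n + 1), E (e t - (α (t + 1) - α t)) +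
        ε * (Finset.range n).sup' hn fun t => ‖α (t + 1)‖) :
    ∃ lam : ℕ → V, (∀ t ∈ Finset.range (n + 1), lam t ∈ Λ) ∧
      ∑ t ∈ Finset.range n, ‖lam t - lam (t + 1)‖ ≤ ε ∧
      v ≤ ∑ t ∈ Finset.range (n + 1), (⟪lam t, e t⟫ - Estar (lam t)) := by
  obtain ⟨L, hL⟩ := exists_linearMap_add_le_of_convexOn ⟨0, by simp⟩
    (convexOn_sum_add_sup' hE hn e hε) (v := v) (by
      rintro α ⟨h0, h1⟩
      simpa using hv α h0 h1)
  let lam (t : ℕ) : V := (InnerProductSpace.toDual ℝ V).symm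
    (L ∘ₗ LinearMap.single ℝ (fun _ : ℕ => V) t).toContinuousLinearMap
  have hlam (t : ℕ) (z : V) : ⟪lam t, z⟫ = L (Pi.single t z) := by
    simp [lam]
  have key (α z : ℕ → V) (h0 : α 0 = 0) (h1 : α (n + 1) = 0) :
      v + ∑ t ∈ Finset.range (n + 1), ⟪lam t, z t - e t + (α (t + 1) - α t)⟫ ≤
        ∑ t ∈ Finset.range (n + 1), E (z t) +
          ε * (Finset.range n).sup' hn fun t => ‖α (t + 1)‖ := by
    have h := hL α ⟨h0, h1⟩ (∑ t ∈ Finset.range (n + 1),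
      Pi.single t (z t - e t + (α (t + 1) - α t)))
    simp only [map_sum, ← hlam] at h
    refine h.trans (le_of_eq ?_)
    congr 1
    refine Finset.sum_congr rfl fun t ht => congrArg E ?_
    rw [Finset.sum_apply, Finset.sum_eq_single_of_mem t ht
      (fun s _ hs => Pi.single_eq_of_ne' hs _), Pi.single_eq_same]
    abel
  have hsup0 : ((Finset.range n).sup' hn fun _ => (0 : ℝ)) = 0 := Finset.sup'_const _ _
  have key0 (z : ℕ → V) : ∑ t ∈ Finset.range (n + 1), (⟪lam t, z t⟫ - E (z t)) ≤
      ∑ t ∈ Finset.range (n + 1), ⟪lam t, e t⟫ - v := by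
    have h := key 0 z rfl rfl
    simp only [Pi.zero_apply, sub_zero, add_zero, norm_zero, hsup0, mul_zero, inner_sub_right,
      Finset.sum_sub_distrib] at h ⊢
    linarith
  have hmem : ∀ t ∈ Finset.range (n + 1), lam t ∈ Λ := by
    intro t ht
    rw [hdom]
    refine ⟨∑ t ∈ Finset.range (n + 1), ⟪lam t, e t⟫ - v -
      ∑ s ∈ (Finset.range (n + 1)).erase t, (⟪lam s, e s⟫ - E (e s)), ?_⟩
    rintro _ ⟨w, rfl⟩
    have h := key0 (Function.update e t w)
    rw [← Finset.add_sum_erase _ _ ht, Function.update_self] at h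
    rw [Finset.sum_congr rfl (g := fun s => ⟪lam s, e s⟫ - E (e s)) (fun s hs => by
      rw [Function.update_of_ne (Finset.ne_of_mem_erase hs)])] at h
    simp only
    linarith
  refine ⟨lam, hmem, ?_, ?_⟩
  · by_contra! hlt
    set S := ∑ t ∈ Finset.range n, ‖lam t - lam (t + 1)‖
    have hk (k : ℝ) (hk : 0 ≤ k) :
        k * (S - ε) ≤ ∑ t ∈ Finset.range (n + 1), E (e t) - v := by
      let d (t : ℕ) : V := lam t - lam (t + 1)
      let α (t : ℕ) : V := if t = 0 ∨ t = n + 1 then 0 else k • ‖d (t - 1)‖⁻¹ • d (t - 1)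
      have hα (t : ℕ) (ht : t ∈ Finset.range n) : α (t + 1) = k • ‖d t‖⁻¹ • d t := by
        have := Finset.mem_range.1 ht
        simp [α, this.ne]
      have h := key α e (by simp [α]) (by simp [α])
      simp only [sub_self, zero_add] at h
      rw [sum_inner_sub_eq] at h
      have hs : ∑ t ∈ Finset.range n, ⟪lam t - lam (t + 1), α (t + 1)⟫ = k * S := by
        rw [Finset.mul_sum]
        refine Finset.sum_congr rfl fun t ht => ?_
        rw [hα t ht, real_inner_smul_right, real_inner_smul_right,
          real_inner_self_eq_norm_mul_norm]
        by_cases hd : ‖d t‖ = 0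
        · simp [hd, show ‖lam t - lam (t + 1)‖ = 0 from hd]
        · rw [inv_mul_cancel_left₀ hd]
      have hM : ((Finset.range n).sup' hn fun t => ‖α (t + 1)‖) ≤ k := by
        refine Finset.sup'_le _ _ fun t ht => ?_
        rw [hα t ht, norm_smul, norm_smul, norm_inv, norm_norm, Real.norm_of_nonneg hk]
        exact mul_le_of_le_one_right hk inv_mul_le_one
      have h2 := mul_le_mul_of_nonneg_left hM hε
      rw [hs, show α 0 = 0 by simp [α], show α (n + 1) = 0 by simp [α]] at h
      simp only [inner_zero_right] at h
      linarith
    have hpos : 0 < S - ε := sub_pos.2 hlt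
    set B := ∑ t ∈ Finset.range (n + 1), E (e t) - v
    have h := hk ((|B| + 1) / (S - ε)) (by positivity)
    rw [div_mul_cancel₀ _ hpos.ne'] at h
    linarith [le_abs_self B]
  · have h := sum_le_of_forall_isLUB (fun t ht => hstar _ (hmem t ht)) key0
    rw [Finset.sum_sub_distrib]
    linarith

end Duality

/-- Lemma 2 (dual expression of the worst-case dual-sequence gap).
The error vectors `e 0, …, e (T-1)` stand for `e₁*, …, e_T*`; a dual sequence
`lam 0, …, lam (T-1)` stands for `λ_1, …, λ_T`.  The Fenchel conjugate of `E` is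
encoded by the function `Estar` together with: `Λ` is exactly the set of `lam` for
which `z ↦ ⟪lam, z⟫ − E z` is bounded above (i.e. `Λ = dom E*`), and on `Λ` the value
`Estar lam` is the least upper bound of that family.  In the dual expression, the
vector `α` has the convention `α 0 = α T = 0` (its entries `α 1, …, α (T-1)` are free),
and the term at round `t+1` is `E (e t − (α (t+1) − α t))`. -/
theorem stmt_2 {m : ℕ}
    (E : EuclideanSpace ℝ (Fin m) → ℝ) (hEconv : ConvexOn ℝ Set.univ E)
    (Estar : EuclideanSpace ℝ (Fin m) → ℝ)
    (Λ : Set (EuclideanSpace ℝ (Fin m)))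
    (hdom : ∀ lam, lam ∈ Λ ↔ BddAbove (Set.range fun z => ⟪lam, z⟫ - E z))
    (hstar : ∀ lam ∈ Λ, IsLUB (Set.range fun z => ⟪lam, z⟫ - E z) (Estar lam))
    (hΛne : Λ.Nonempty) (hΛcomp : IsCompact Λ)
    (T : ℕ) (hT : 2 ≤ T)
    (e : ℕ → EuclideanSpace ℝ (Fin m))
    (ebar : EuclideanSpace ℝ (Fin m))
    (hebar : ebar = (1 / T : ℝ) • ∑ t ∈ Finset.range T, e t)
    (ε : ℝ) (hε : 0 < ε) :
    sSup {S : ℝ | ∃ lam : ℕ → EuclideanSpace ℝ (Fin m),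
        (∀ t ∈ Finset.range T, lam t ∈ Λ) ∧
        (∑ t ∈ Finset.range (T - 1), ‖lam t - lam (t + 1)‖) ≤ ε ∧
        S = (1 / T : ℝ) * ∑ t ∈ Finset.range T, (⟪lam t, e t⟫ - Estar (lam t)) - E ebar} =
    sInf {S : ℝ | ∃ α : ℕ → EuclideanSpace ℝ (Fin m), α 0 = 0 ∧ α T = 0 ∧
        S = (1 / T : ℝ) * ∑ t ∈ Finset.range T, E (e t - (α (t + 1) - α t)) - E ebar +
          (ε / T) * ((Finset.range (T - 1)).sup'
            (Finset.nonempty_range_iff.mpr (by omega)) fun t => ‖α (t + 1)‖)} := by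
  obtain ⟨n, rfl⟩ : ∃ n, T = n + 1 := ⟨T - 1, by omega⟩
  have hn : (Finset.range n).Nonempty := Finset.nonempty_range_iff.mpr (by omega)
  have hT0 : (0 : ℝ) < ((n + 1 : ℕ) : ℝ) := by positivity
  obtain ⟨l₀, hl₀⟩ := hΛne
  have hweak : ∀ lam α : ℕ → EuclideanSpace ℝ (Fin m),
      (∀ t ∈ Finset.range (n + 1), lam t ∈ Λ) →
      ∑ t ∈ Finset.range n, ‖lam t - lam (t + 1)‖ ≤ ε → α 0 = 0 → α (n + 1) = 0 →
      (1 / (n + 1 : ℕ) : ℝ) * ∑ t ∈ Finset.range (n + 1), (⟪lam t, e t⟫ - Estar (lam t)) -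
          E ebar ≤
        (1 / (n + 1 : ℕ) : ℝ) * ∑ t ∈ Finset.range (n + 1), E (e t - (α (t + 1) - α t)) -
          E ebar + (ε / (n + 1 : ℕ)) * (Finset.range n).sup' hn fun t => ‖α (t + 1)‖ := by
    intro lam α hmem hlam h0 h1
    have h := sum_inner_sub_conjugate_le hn (e := e) (fun t ht => hstar _ (hmem t ht)) hlam h0 h1
    have h' := mul_le_mul_of_nonneg_left h (one_div_pos.2 hT0).le
    rw [mul_add, ← mul_assoc, one_div_mul_eq_div _ ε] at h'
    linarith
  have hconst : ∑ t ∈ Finset.range n, ‖l₀ - l₀‖ ≤ ε := by simpa using hε.le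
  apply le_antisymm
  · refine csSup_le ⟨_, fun _ => l₀, fun _ _ => hl₀, hconst, rfl⟩ ?_
    rintro _ ⟨lam, hmem, hlam, rfl⟩
    refine le_csInf ⟨_, 0, rfl, rfl, rfl⟩ ?_
    rintro _ ⟨α, h0, h1, rfl⟩
    exact hweak lam α hmem hlam h0 h1
  · set D : ℝ := sInf _
    obtain ⟨lam, hmem, hlam, hle⟩ := exists_le_sum_inner_sub_conjugate hEconv hdom hstar hn e
      hε.le (v := (n + 1 : ℕ) * (D + E ebar)) (by
        intro α h0 h1
        have h : D ≤ (1 / (n + 1 : ℕ) : ℝ) *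
              ∑ t ∈ Finset.range (n + 1), E (e t - (α (t + 1) - α t)) -
            E ebar + (ε / (n + 1 : ℕ)) * (Finset.range n).sup' hn fun t => ‖α (t + 1)‖ := by
          refine csInf_le ⟨(1 / (n + 1 : ℕ) : ℝ) *
            ∑ t ∈ Finset.range (n + 1), (⟪l₀, e t⟫ - Estar l₀) - E ebar, ?_⟩ ⟨α, h0, h1, rfl⟩
          rintro _ ⟨β, h2, h3, rfl⟩
          exact hweak (fun _ => l₀) β (fun _ _ => hl₀) hconst h2 h3
        rw [← le_div_iff₀' hT0, add_div, ← one_div_mul_eq_div, ← div_mul_eq_mul_div]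
        linarith)
    rw [← le_div_iff₀' hT0, ← one_div_mul_eq_div, ← le_sub_iff_add_le] at hle
    refine hle.trans (le_csSup ⟨(1 / (n + 1 : ℕ) : ℝ) *
        ∑ t ∈ Finset.range (n + 1),
          E (e t - ((0 : ℕ → EuclideanSpace ℝ (Fin m)) (t + 1) -
            (0 : ℕ → EuclideanSpace ℝ (Fin m)) t)) - E ebar +
        (ε / (n + 1 : ℕ)) * (Finset.range n).sup' hn
          fun t => ‖(0 : ℕ → EuclideanSpace ℝ (Fin m)) (t + 1)‖, ?_⟩ ⟨lam, hmem, hlam, rfl⟩)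
    rintro _ ⟨μ, hμ, hμ', rfl⟩
    exact hweak μ 0 hμ hμ' rfl rfl
end

section
/- Lemma 3 (smoothness bound on the dual-sequence gap): Let ℰ : ℝ^m → ℝ be convex, let ℰ*(λ) = sup_{z ∈ ℝ^m} (⟨λ, z⟩ − ℰ(z)), and assume Λ := {λ ∈ ℝ^m : ℰ*(λ) < +∞} is nonempty and compact. Let T ≥ 2, e₁*,…,e_T* ∈ ℝ^m, ē = (1/T) Σ_{t=1}^T e_t*, ε ≥ 0, and let S_e be the supremum over all (λ_1,…,λ_T) ∈ Λ^T with Σ_{t=1}^{T−1} ‖λ_t − λ_{t+1}‖₂ ≤ ε of (1/T) Σ_{t=1}^T ( ⟨λ_t, e_t*⟩ − ℰ*(λ_t) ) − ℰ(ē). Then S_e ≤ (ε/T) · max_{1 ≤ t ≤ T−1} Ψ_t, where Ψ_t = ‖ Σ_{j=1}^t ((T−t)/T) e_j* − Σ_{j=t+1}^T (t/T) e_j* ‖₂. -/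
local notation "⟪" x ", " y "⟫" => @inner ℝ _ _ x y

/-- Summation by parts for inner products, with partial sums of the second sequence. -/
theorem sum_inner_by_parts {F : Type*} [NormedAddCommGroup F] [InnerProductSpace ℝ F]
    (lam d : ℕ → F) (n : ℕ) :
    ∑ t ∈ Finset.range (n + 1), ⟪lam t, d t⟫ =
      ⟪lam n, ∑ j ∈ Finset.range (n + 1), d j⟫ +
        ∑ s ∈ Finset.range n, ⟪lam s - lam (s + 1), ∑ j ∈ Finset.range (s + 1), d j⟫ := by
  induction n with
  | zero => simp
  | succ n ih =>
    rw [Finset.sum_range_succ, ih, Finset.sum_range_succ d (n + 1), inner_add_right,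
      Finset.sum_range_succ (fun s => ⟪lam s - lam (s + 1), ∑ j ∈ Finset.range (s + 1), d j⟫) n,
      inner_sub_left]
    ring

/-- Partial sums of a centred sequence as a weighted difference of head and tail sums. -/
theorem sum_range_sub_mean {F : Type*} [AddCommGroup F] [Module ℝ F] (e : ℕ → F) {k T : ℕ}
    (hT : T ≠ 0) (hk : k ≤ T) :
    ∑ j ∈ Finset.range k, (e j - (1 / T : ℝ) • ∑ t ∈ Finset.range T, e t) =
      (((T : ℝ) - k) / T) • (∑ j ∈ Finset.range k, e j) -
        ((k : ℝ) / T) • ∑ j ∈ Finset.Ico k T, e j := by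
  have hT' : (T : ℝ) ≠ 0 := Nat.cast_ne_zero.mpr hT
  rw [Finset.sum_sub_distrib, Finset.sum_const, Finset.card_range,
    ← Finset.sum_range_add_sum_Ico e hk, ← Nat.cast_smul_eq_nsmul ℝ]
  match_scalars <;> field_simp

/-- If the second sequence sums to zero and its partial sums are bounded by `M`, the sum of inner
products is at most `M` times the path length of the first sequence. -/
theorem sum_inner_le_path_length_mul {F : Type*} [NormedAddCommGroup F] [InnerProductSpace ℝ F]
    (lam d : ℕ → F) (n : ℕ) (hd : ∑ j ∈ Finset.range (n + 1), d j = 0) {M : ℝ}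
    (hM : ∀ s ∈ Finset.range n, ‖∑ j ∈ Finset.range (s + 1), d j‖ ≤ M) :
    ∑ t ∈ Finset.range (n + 1), ⟪lam t, d t⟫ ≤
      (∑ s ∈ Finset.range n, ‖lam s - lam (s + 1)‖) * M := by
  rw [sum_inner_by_parts, hd, inner_zero_right, zero_add, Finset.sum_mul]
  exact Finset.sum_le_sum fun s hs => (real_inner_le_norm _ _).trans
    (mul_le_mul_of_nonneg_left (hM s hs) (norm_nonneg _))

/-- Lemma 3 (smoothness bound on the dual-sequence gap).
The error vectors `e 0, …, e (T-1)` stand for `e₁*, …, e_T*`.  The Fenchel conjugate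
of `E` is encoded by `Estar` and its domain `Λ` as in Lemma 2.  For the paper's index
`t ∈ {1, …, T-1}` (here `t = s + 1` with `s ∈ range (T-1)`),
`Ψ_t = ‖((T−t)/T) Σ_{j≤t} e_j − (t/T) Σ_{j>t} e_j‖₂`: with 0-based indices the first
sum is over `j ∈ range t` and the second over `j ∈ Ico t T`. -/
theorem stmt_3 {m : ℕ}
    (E : EuclideanSpace ℝ (Fin m) → ℝ) (hEconv : ConvexOn ℝ Set.univ E)
    (Estar : EuclideanSpace ℝ (Fin m) → ℝ)
    (Λ : Set (EuclideanSpace ℝ (Fin m)))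
    (hdom : ∀ lam, lam ∈ Λ ↔ BddAbove (Set.range fun z => ⟪lam, z⟫ - E z))
    (hstar : ∀ lam ∈ Λ, IsLUB (Set.range fun z => ⟪lam, z⟫ - E z) (Estar lam))
    (hΛne : Λ.Nonempty) (hΛcomp : IsCompact Λ)
    (T : ℕ) (hT : 2 ≤ T)
    (e : ℕ → EuclideanSpace ℝ (Fin m))
    (ebar : EuclideanSpace ℝ (Fin m))
    (hebar : ebar = (1 / T : ℝ) • ∑ t ∈ Finset.range T, e t)
    (ε : ℝ) (hε : 0 ≤ ε) :
    sSup {S : ℝ | ∃ lam : ℕ → EuclideanSpace ℝ (Fin m),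
        (∀ t ∈ Finset.range T, lam t ∈ Λ) ∧
        (∑ t ∈ Finset.range (T - 1), ‖lam t - lam (t + 1)‖) ≤ ε ∧
        S = (1 / T : ℝ) * ∑ t ∈ Finset.range T, (⟪lam t, e t⟫ - Estar (lam t)) - E ebar} ≤
    (ε / T) * ((Finset.range (T - 1)).sup' (Finset.nonempty_range_iff.mpr (by omega))
      fun s => ‖(((T : ℝ) - (s + 1)) / T) • (∑ j ∈ Finset.range (s + 1), e j) -
        (((s : ℝ) + 1) / T) • ∑ j ∈ Finset.Ico (s + 1) T, e j‖) := by
  have hT0 : T ≠ 0 := by omega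
  have hTpos : (0 : ℝ) < T := by positivity
  set Ψ : ℕ → ℝ := fun s =>
    ‖(((T : ℝ) - (s + 1)) / T) • (∑ j ∈ Finset.range (s + 1), e j) -
      (((s : ℝ) + 1) / T) • ∑ j ∈ Finset.Ico (s + 1) T, e j‖ with hΨ
  set M := (Finset.range (T - 1)).sup' (Finset.nonempty_range_iff.mpr (by omega)) Ψ
  have hΨM : ∀ s ∈ Finset.range (T - 1), Ψ s ≤ M := fun s hs => Finset.le_sup' Ψ hs
  have hM0 : 0 ≤ M := (norm_nonneg _).trans (hΨM 0 (Finset.mem_range.mpr (by omega)))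
  refine Real.sSup_le ?_ (by positivity)
  rintro S ⟨lam, hlam, hpath, rfl⟩
  have hcentre : ∀ s < T, ‖∑ j ∈ Finset.range (s + 1), (e j - ebar)‖ = Ψ s := fun s hs => by
    rw [hebar, sum_range_sub_mean e hT0 (Nat.succ_le_of_lt hs), hΨ]
    push_cast
    rfl
  have hzero : ∑ j ∈ Finset.range (T - 1 + 1), (e j - ebar) = 0 := by
    rw [Nat.sub_add_cancel (by omega), hebar, sum_range_sub_mean e hT0 le_rfl]
    simp
  have hparts := sum_inner_le_path_length_mul lam (fun j => e j - ebar) (T - 1) hzero (M := M)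
    fun s hs => (hcentre s (by have := Finset.mem_range.mp hs; omega)).trans_le (hΨM s hs)
  rw [Nat.sub_add_cancel (by omega)] at hparts
  have hyoung : ∑ t ∈ Finset.range T, (⟪lam t, e t⟫ - Estar (lam t)) ≤
      ∑ t ∈ Finset.range T, (⟪lam t, e t - ebar⟫ + E ebar) :=
    Finset.sum_le_sum fun t ht => by
      have : ⟪lam t, ebar⟫ - E ebar ≤ Estar (lam t) := (hstar _ (hlam t ht)).1 ⟨ebar, rfl⟩
      rw [inner_sub_right]
      linarith
  rw [Finset.sum_add_distrib, Finset.sum_const, Finset.card_range, nsmul_eq_mul] at hyoung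
  have hbound := mul_le_mul_of_nonneg_right hpath hM0
  calc (1 / T : ℝ) * ∑ t ∈ Finset.range T, (⟪lam t, e t⟫ - Estar (lam t)) - E ebar
      ≤ (1 / T : ℝ) * (ε * M + T * E ebar) - E ebar := by
        gcongr
        linarith
    _ = ε / T * M := by
        field_simp
        ring
end

section
/- Lemma 5, first part (dynamic regret of the online projected subgradient method tracking the constraint matrices): Let 𝒜 be a nonempty closed convex subset of the space ℝ^{m×d} of m × d real matrices equipped with the Frobenius inner product, with ‖A‖_F ≤ R_A for all A ∈ 𝒜 where R_A > 0. Let T ≥ 1 and let A_1,…,A_{T+1} ∈ 𝒜. Suppose Â_1,…,Â_T are generated by Â_1 ∈ 𝒜 and Â_{t+1} = Π_𝒜( Â_t − ν_t G_t ) with step size ν_t = R_A/√t, where G_t ∈ ℝ^{m×d} satisfies ‖G_t‖_F ≤ 1 and the subgradient inequality ‖A_t − B‖_F ≥ ‖A_t − Â_t‖_F + ⟨G_t, B − Â_t⟩ for all B ∈ 𝒜. Then (1/T) Σ_{t=1}^T ‖Â_t − A_t‖_F ≤ (3/√T) [ R_A + Σ_{t=1}^T ‖A_t − A_{t+1}‖_F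 ]. -/
local notation "⟪" x ", " y "⟫" => @inner ℝ _ _ x y

section OnlineSubgradient

variable {E : Type*} [NormedAddCommGroup E] [InnerProductSpace ℝ E]

/-- A minimizer of the distance to `y` over a convex set is no farther from any point of the
set than `y` is. -/
lemma norm_sub_le_of_forall_norm_sub_le {K : Set E} (hK : Convex ℝ K) {y p b : E}
    (hp : p ∈ K) (hmin : ∀ z ∈ K, ‖y - p‖ ≤ ‖y - z‖) (hb : b ∈ K) :
    ‖p - b‖ ≤ ‖y - b‖ := by
  have : Nonempty K := ⟨⟨p, hp⟩⟩
  have hinf : ‖y - p‖ = ⨅ w : K, ‖y - w‖ :=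
    le_antisymm (le_ciInf fun w => hmin w w.2)
      (ciInf_le (f := fun w : K => ‖y - w‖)
        ⟨0, by rintro _ ⟨w, rfl⟩; exact norm_nonneg _⟩ ⟨p, hp⟩)
  have hvar := (norm_eq_iInf_iff_real_inner_le_zero hK hp).1 hinf b hb
  have hexp := norm_add_sq_real (y - p) (p - b)
  rw [sub_add_sub_cancel, ← neg_sub b p, inner_neg_right, norm_neg, norm_sub_rev b p] at hexp
  refine le_of_sq_le_sq ?_ (norm_nonneg _)
  nlinarith [sq_nonneg ‖y - p‖]

/-- One step of the projected subgradient method with step size `R / s`, for the loss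
`‖a - ·‖`, compared with the next target `a'`. -/
lemma norm_sub_le_of_projected_subgradient_step {K : Set E} (hK : Convex ℝ K) {R s : ℝ}
    (hR : 0 < R) (hs : 0 < s) (hbdd : ∀ z ∈ K, ‖z‖ ≤ R) {x p a a' g : E}
    (ha : a ∈ K) (ha' : a' ∈ K) (hg : ‖g‖ ≤ 1)
    (hsub : ‖a - x‖ ≤ inner ℝ g (x - a)) (hp : p ∈ K)
    (hmin : ∀ z ∈ K, ‖x - (R / s) • g - p‖ ≤ ‖x - (R / s) • g - z‖) :
    ‖x - a‖ ≤ s / (2 * R) * (‖x - a‖ ^ 2 - ‖p - a'‖ ^ 2) + 2 * s * ‖a - a'‖ + R / (2 * s) := by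
  have hproj := norm_sub_le_of_forall_norm_sub_le hK hp hmin ha
  have hsq : ‖p - a‖ ^ 2 ≤ ‖x - (R / s) • g - a‖ ^ 2 := by gcongr
  have hexp : ‖x - (R / s) • g - a‖ ^ 2
      = ‖x - a‖ ^ 2 - 2 * (R / s) * inner ℝ g (x - a) + (R / s) ^ 2 * ‖g‖ ^ 2 := by
    rw [sub_right_comm, norm_sub_sq_real, inner_smul_right, real_inner_comm, norm_smul,
      mul_pow, Real.norm_eq_abs, sq_abs]
    ring
  have hg2 : ‖g‖ ^ 2 ≤ 1 := pow_le_one₀ (norm_nonneg _) hg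
  have hη : 0 < R / s := by positivity
  rw [norm_sub_rev a x] at hsub
  have hdesc : ‖p - a‖ ^ 2 ≤ ‖x - a‖ ^ 2 - 2 * (R / s) * ‖x - a‖ + (R / s) ^ 2 := by
    nlinarith [mul_le_mul_of_nonneg_left hsub hη.le,
      mul_le_mul_of_nonneg_left hg2 (sq_nonneg (R / s))]
  have htri : ‖p - a'‖ ≤ ‖p - a‖ + ‖a - a'‖ := norm_sub_le_norm_sub_add_norm_sub _ _ _
  have hdiam {u v : E} (hu : u ∈ K) (hv : v ∈ K) : ‖u - v‖ ≤ 2 * R := by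
    linarith [norm_sub_le u v, hbdd u hu, hbdd v hv]
  have hdrift : ‖p - a'‖ ^ 2 - ‖p - a‖ ^ 2 ≤ 4 * R * ‖a - a'‖ := by
    nlinarith [hdiam hp ha, hdiam hp ha', norm_nonneg (p - a), norm_nonneg (p - a'),
      norm_nonneg (a - a')]
  have hscaled := mul_le_mul_of_nonneg_left (add_le_add hdesc hdrift)
    (show 0 ≤ s / (2 * R) by positivity)
  have h₁ : s / (2 * R) * (2 * (R / s) * ‖x - a‖) = ‖x - a‖ := by field_simp
  have h₂ : s / (2 * R) * (R / s) ^ 2 = R / (2 * s) := by field_simp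
  have h₃ : s / (2 * R) * (4 * R * ‖a - a'‖) = 2 * s * ‖a - a'‖ := by field_simp; norm_num
  linarith

end OnlineSubgradient

lemma one_div_two_mul_sqrt_add_one_le (n : ℕ) :
    1 / (2 * √((n : ℝ) + 1)) ≤ √((n : ℝ) + 1) - √(n : ℝ) := by
  have hs : 0 < √((n : ℝ) + 1) := by positivity
  rw [div_le_iff₀ (by positivity)]
  nlinarith [sq_nonneg (√((n : ℝ) + 1) - √(n : ℝ)), Real.sq_sqrt (show (0 : ℝ) ≤ n by positivity),
    Real.sq_sqrt (show (0 : ℝ) ≤ n + 1 by positivity)]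

/-- Lemma 5, first part (dynamic regret of the online projected subgradient method
tracking the constraint matrices).  The space `ℝ^{m×d}` with the Frobenius inner
product is encoded as `EuclideanSpace ℝ (Fin m × Fin d)` (so `‖·‖` is the Frobenius
norm).  Rounds are indexed by `t ∈ {0, …, T-1}` (round `t+1` in the paper), so the
matrices `A_1, …, A_{T+1}` are `A 0, …, A T` and the step size `ν_t = R_A/√t` becomes
`R_A/√(t+1)`.  The projection `Π_𝒜(y)` is encoded by requiring `Ahat (t+1) ∈ 𝒜` and
that it minimizes the (Frobenius) distance to `y` over `𝒜`. -/
theorem stmt_8 {m d : ℕ}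
    (𝒜 : Set (EuclideanSpace ℝ (Fin m × Fin d)))
    (h𝒜ne : 𝒜.Nonempty) (h𝒜closed : IsClosed 𝒜) (h𝒜convex : Convex ℝ 𝒜)
    (RA : ℝ) (hRA : 0 < RA) (h𝒜bdd : ∀ B ∈ 𝒜, ‖B‖ ≤ RA)
    (T : ℕ) (hT : 1 ≤ T)
    (A : ℕ → EuclideanSpace ℝ (Fin m × Fin d))
    (hAmem : ∀ t ∈ Finset.range (T + 1), A t ∈ 𝒜)
    (Ahat Gsub : ℕ → EuclideanSpace ℝ (Fin m × Fin d))
    (hAhat0 : Ahat 0 ∈ 𝒜)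
    (hGnorm : ∀ t ∈ Finset.range T, ‖Gsub t‖ ≤ 1)
    (hGsubgrad : ∀ t ∈ Finset.range T, ∀ B ∈ 𝒜,
      ‖A t - B‖ ≥ ‖A t - Ahat t‖ + ⟪Gsub t, B - Ahat t⟫)
    (hproj : ∀ t ∈ Finset.range T, Ahat (t + 1) ∈ 𝒜 ∧
      ∀ B ∈ 𝒜, ‖Ahat t - (RA / Real.sqrt (t + 1)) • Gsub t - Ahat (t + 1)‖ ≤
        ‖Ahat t - (RA / Real.sqrt (t + 1)) • Gsub t - B‖) :
    (1 / T : ℝ) * ∑ t ∈ Finset.range T, ‖Ahat t - A t‖ ≤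
      (3 / Real.sqrt T) * (RA + ∑ t ∈ Finset.range T, ‖A t - A (t + 1)‖) := by
  have hAhat : ∀ n ≤ T, Ahat n ∈ 𝒜
    | 0, _ => hAhat0
    | n + 1, hn => (hproj n (Finset.mem_range.2 hn)).1
  have hA (n : ℕ) (hn : n ≤ T) : A n ∈ 𝒜 := hAmem n (Finset.mem_range.2 (by omega))
  have hregret : ∀ n ≤ T, ∑ t ∈ Finset.range n, ‖Ahat t - A t‖ ≤
      3 * RA * √(n : ℝ) + 2 * √(n : ℝ) * ∑ t ∈ Finset.range n, ‖A t - A (t + 1)‖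
        - √(n : ℝ) / (2 * RA) * ‖Ahat n - A n‖ ^ 2 := by
    intro n
    induction n with
    | zero => simp
    | succ n ih =>
      intro hn
      have hnT := Finset.mem_range.2 hn
      have hs : 0 < √((n : ℝ) + 1) := by positivity
      have hsub : ‖A n - Ahat n‖ ≤ inner ℝ (Gsub n) (Ahat n - A n) := by
        have h := hGsubgrad n hnT (A n) (hA n (by omega))
        rw [sub_self, norm_zero, ← neg_sub (Ahat n) (A n), inner_neg_right, norm_neg,
          norm_sub_rev] at h
        linarith
      have hstep := norm_sub_le_of_projected_subgradient_step h𝒜convex hRA hs h𝒜bdd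
        (hA n (by omega)) (hA (n + 1) hn) (hGnorm n hnT) hsub (hproj n hnT).1 (hproj n hnT).2
      have hdist : ‖Ahat n - A n‖ ≤ 2 * RA := by
        linarith [norm_sub_le (Ahat n) (A n), h𝒜bdd _ (hAhat n (by omega)),
          h𝒜bdd _ (hA n (by omega))]
      have hdist_sq : ‖Ahat n - A n‖ ^ 2 / (2 * RA) ≤ 2 * RA := by
        rw [div_le_iff₀ (by positivity)]
        nlinarith [norm_nonneg (Ahat n - A n)]
      have hmono : √(n : ℝ) ≤ √((n : ℝ) + 1) := Real.sqrt_le_sqrt (by linarith)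
      have hweight := mul_le_mul_of_nonneg_left hdist_sq (sub_nonneg.2 hmono)
      have hgap := mul_le_mul_of_nonneg_left (one_div_two_mul_sqrt_add_one_le n) hRA.le
      rw [mul_one_div] at hgap
      have hvar := mul_le_mul_of_nonneg_right hmono
        (Finset.sum_nonneg fun t (_ : t ∈ Finset.range n) => norm_nonneg (A t - A (t + 1)))
      rw [Finset.sum_range_succ, Finset.sum_range_succ, Nat.cast_add_one]
      have hprev := ih (by omega)
      ring_nf at hprev hstep hweight hgap hvar ⊢
      linarith
  have hTpos : (0 : ℝ) < T := by exact_mod_cast hT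
  have hsT : 0 < √(T : ℝ) := Real.sqrt_pos.2 hTpos
  have hvar : 0 ≤ ∑ t ∈ Finset.range T, ‖A t - A (t + 1)‖ :=
    Finset.sum_nonneg fun _ _ => norm_nonneg _
  have hbound : ∑ t ∈ Finset.range T, ‖Ahat t - A t‖ ≤
      3 * √(T : ℝ) * (RA + ∑ t ∈ Finset.range T, ‖A t - A (t + 1)‖) := by
    have hrem : 0 ≤ √(T : ℝ) / (2 * RA) * ‖Ahat T - A T‖ ^ 2 := by positivity
    nlinarith [hregret T le_rfl, mul_nonneg hsT.le hvar]
  calc (1 / T : ℝ) * ∑ t ∈ Finset.range T, ‖Ahat t - A t‖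
      ≤ 1 / T * (3 * √(T : ℝ) * (RA + ∑ t ∈ Finset.range T, ‖A t - A (t + 1)‖)) := by gcongr
    _ = 3 / √(T : ℝ) * (RA + ∑ t ∈ Finset.range T, ‖A t - A (t + 1)‖) := by
      rw [← mul_assoc]
      congr 1
      field_simp
      rw [Real.sq_sqrt hTpos.le]
end
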